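/- With the notation of the context, there exist a positive integer K₀, constants 𝔠 > 0, 0 < δ, ε₀ < 1 and 𝔠̃ > 0 (all depending only on κ and D), and for each t ∈ {1,…,K₀} families D^t_k (k ∈ ℤ) of measurable subsets of X with points c(Q) ∈ X, such that each system D^t = ⋃_{k∈ℤ} D^t_k satisfies properties (1)–(6) of the dyadic decomposition (with the same constants 𝔠, δ, ε₀ for every t), and in addition: for every x ∈ X and every s > 0 there exist t ∈ {1,…,K₀}, k ∈ ℤ and Q ∈ D^t_k with B(x,s) ⊆ Q and δ^k ≤ 𝔠̃ s. -/

import Mathlib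

open Set MeasureTheory
open scoped ENNReal

/-- `ρ` is a quasimetric with quasi-triangle constant `κ ≥ 1`. -/
structure IsQuasimetric {X : Type*} (ρ : X → X → ℝ) (κ : ℝ) : Prop where
  one_le : 1 ≤ κ
  nonneg : ∀ x y, 0 ≤ ρ x y
  eq_zero_iff : ∀ x y, ρ x y = 0 ↔ x = y
  comm : ∀ x y, ρ x y = ρ y x
  triangle : ∀ x y z, ρ x y ≤ κ * (ρ x z + ρ z y)

/-- The balls of `ρ` are measurable and `μ` is doubling on them with constant `D`. -/
structure IsDoublingFor {X : Type*} [MeasurableSpace X] (ρ : X → X → ℝ) (μ : Measure X)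
    (D : ℝ) : Prop where
  measurableSet_ball : ∀ (x : X) (t : ℝ), MeasurableSet {y : X | ρ x y < t}
  doubling : ∀ (x : X) (t : ℝ), 0 < t →
    0 < μ {y : X | ρ x y < 2 * t} ∧
    μ {y : X | ρ x y < 2 * t} ≤ ENNReal.ofReal D * μ {y : X | ρ x y < t} ∧
    μ {y : X | ρ x y < t} < ⊤

/-- A `t`-net: a `t`-separated set such that every point is at distance less than `t` from it. -/
structure IsNetOf {X : Type*} (ρ : X → X → ℝ) (t : ℝ) (S : Set X) : Prop where
  separated : S.Pairwise fun x y => t ≤ ρ x y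
  dense : ∀ x, ∃ z ∈ S, ρ x z < t

section Quasimetric

variable {X : Type*} {ρ : X → X → ℝ} {κ : ℝ}

lemma IsQuasimetric.self (h : IsQuasimetric ρ κ) (x : X) : ρ x x = 0 :=
  (h.eq_zero_iff x x).2 rfl

lemma IsQuasimetric.pos (h : IsQuasimetric ρ κ) : 0 < κ :=
  lt_of_lt_of_le one_pos h.one_le

lemma IsQuasimetric.lt_of_lt_of_lt (h : IsQuasimetric ρ κ) {x y z : X} {s t : ℝ}
    (hxz : ρ x z < s) (hzy : ρ z y < t) : ρ x y < κ * (s + t) :=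
  (h.triangle x y z).trans_lt (mul_lt_mul_of_pos_left (add_lt_add hxz hzy) h.pos)

lemma IsQuasimetric.exists_maximal_separated (h : IsQuasimetric ρ κ) {t : ℝ} (ht : 0 < t)
    {S Y : Set X} (hSY : S ⊆ Y) (hS : S.Pairwise fun x y => t ≤ ρ x y) :
    ∃ T, S ⊆ T ∧ T ⊆ Y ∧ (T.Pairwise fun x y => t ≤ ρ x y) ∧ ∀ x ∈ Y, ∃ z ∈ T, ρ x z < t := by
  obtain ⟨T, hST, hT⟩ := zorn_subset_nonempty
    {T : Set X | T ⊆ Y ∧ T.Pairwise fun x y => t ≤ ρ x y}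
    (fun c hc hchain _ => ⟨⋃₀ c, ⟨sUnion_subset fun s hs => (hc hs).1,
      (pairwise_sUnion hchain.directedOn).2 fun s hs => (hc hs).2⟩,
      fun s hs => subset_sUnion_of_mem hs⟩) S ⟨hSY, hS⟩
  refine ⟨T, hST, hT.prop.1, hT.prop.2, fun x hx => ?_⟩
  by_contra! hfar
  have hins : insert x T ⊆ T := hT.2 ⟨insert_subset hx hT.prop.1,
    hT.prop.2.insert fun y hy _ => ⟨hfar y hy, (h.comm y x).symm ▸ hfar y hy⟩⟩ (subset_insert x T)
  have := hfar x (hins (mem_insert x T))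
  rw [h.self] at this
  linarith

/-- Either finitely many `s`-nets together are `t`-dense, or some ball of radius `s` contains
as many `t`-separated points as there are nets. -/
lemma IsQuasimetric.exists_nets (h : IsQuasimetric ρ κ) {s t : ℝ} (hs : 0 < s) (ht : 0 < t)
    (n : ℕ) :
    ∃ N : ℕ → Set X, (∀ i, IsNetOf ρ s (N i)) ∧
      ∀ x, (∃ i < n, ∃ z ∈ N i, ρ x z < t) ∨
        ∃ F : Finset X, F.card = n ∧ (∀ z ∈ F, ρ x z < s ∧ ∃ i < n, z ∈ N i) ∧
          (F : Set X).Pairwise fun y z => t ≤ ρ y z := by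
  classical
  induction n with
  | zero =>
    obtain ⟨T, -, -, hsep, hd⟩ := h.exists_maximal_separated hs (empty_subset univ)
      (pairwise_empty _)
    exact ⟨fun _ => T, fun _ => ⟨hsep, fun x => hd x (mem_univ x)⟩,
      fun x => Or.inr ⟨∅, by simp⟩⟩
  | succ n ih =>
    obtain ⟨N, hN, hF⟩ := ih
    obtain ⟨C, -, hCY, hCsep, hCd⟩ := h.exists_maximal_separated hs
      (empty_subset {x | ∀ i < n, ∀ z ∈ N i, t ≤ ρ x z}) (pairwise_empty _)
    obtain ⟨T, hCT, -, hTsep, hTd⟩ := h.exists_maximal_separated hs (subset_univ C) hCsep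
    have hlt : ∀ i < n, Function.update N n T i = N i := fun i hi =>
      Function.update_of_ne hi.ne _ _
    refine ⟨Function.update N n T, fun i => ?_, fun x => ?_⟩
    · rcases eq_or_ne i n with rfl | hi
      · rw [Function.update_self]
        exact ⟨hTsep, fun x => hTd x (mem_univ x)⟩
      · rw [Function.update_of_ne hi]
        exact hN i
    · rcases hF x with ⟨i, hi, z, hz, hxz⟩ | ⟨F, hcard, hFx, hFsep⟩
      · exact Or.inl ⟨i, hi.trans n.lt_succ_self, z, (hlt i hi).symm ▸ hz, hxz⟩
      by_cases hx : ∀ i < n, ∀ z ∈ N i, t ≤ ρ x z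
      · obtain ⟨c, hc, hxc⟩ := hCd x hx
        have hcF : ∀ z ∈ F, t ≤ ρ c z := fun z hz => by
          obtain ⟨-, i, hi, hzi⟩ := hFx z hz
          exact hCY hc i hi z hzi
        refine Or.inr ⟨insert c F, ?_, fun z hz => ?_, ?_⟩
        · rw [Finset.card_insert_of_notMem, hcard]
          intro hmem
          have := hcF c hmem
          rw [h.self] at this
          linarith
        · rcases Finset.mem_insert.1 hz with rfl | hz
          · exact ⟨hxc, n, n.lt_succ_self, by rw [Function.update_self]; exact hCT hc⟩
          · obtain ⟨hxz, i, hi, hzi⟩ := hFx z hz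
            exact ⟨hxz, i, hi.trans n.lt_succ_self, (hlt i hi).symm ▸ hzi⟩
        · rw [Finset.coe_insert]
          exact hFsep.insert fun z hz _ => ⟨hcF z hz, (h.comm z c).symm ▸ hcF z hz⟩
      · push Not at hx
        obtain ⟨i, hi, z, hz, hxz⟩ := hx
        exact Or.inl ⟨i, hi.trans n.lt_succ_self, z, (hlt i hi).symm ▸ hz, hxz⟩

/-- A map into an `s`-net moving points by less than `s`, and sending each point that is close
to an element of the net to that element. -/
lemma IsQuasimetric.exists_projection (h : IsQuasimetric ρ κ) {s : ℝ} {N : Set X}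
    (hN : IsNetOf ρ s N) :
    ∃ p : X → X, (∀ w, p w ∈ N ∧ ρ w (p w) < s) ∧
      ∀ w, ∀ z ∈ N, ρ w z < s / (2 * κ) → p w = z := by
  have hκ := h.pos
  have key : ∀ w, ∃ q, (q ∈ N ∧ ρ w q < s) ∧ ∀ z ∈ N, ρ w z < s / (2 * κ) → q = z := by
    intro w
    by_cases hw : ∃ z ∈ N, ρ w z < s / (2 * κ)
    · obtain ⟨z, hz, hwz⟩ := hw
      have hs : 0 < s / (2 * κ) := (h.nonneg w z).trans_lt hwz
      have hs' : s = 2 * κ * (s / (2 * κ)) := by field_simp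
      refine ⟨z, ⟨hz, hwz.trans_le ?_⟩, fun z' hz' hwz' => ?_⟩
      · nlinarith [h.one_le]
      · by_contra hne
        have h1 := hN.separated hz hz' hne
        have h2 := h.lt_of_lt_of_lt (h.comm w z ▸ hwz) hwz'
        linarith
    · obtain ⟨z, hz, hwz⟩ := hN.dense w
      exact ⟨z, ⟨hz, hwz⟩, fun z' hz' hwz' => absurd ⟨z', hz', hwz'⟩ hw⟩
  choose p hp using key
  exact ⟨p, fun w => (hp w).1, fun w => (hp w).2⟩

end Quasimetric

section Doubling

variable {X : Type*} [MeasurableSpace X] {ρ : X → X → ℝ} {μ : Measure X} {κ D : ℝ}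

lemma IsDoublingFor.measure_ball_pos (h : IsDoublingFor ρ μ D) (x : X) {t : ℝ} (ht : 0 < t) :
    0 < μ {y | ρ x y < t} := by
  have := (h.doubling x (t / 2) (half_pos ht)).1
  rwa [mul_div_cancel₀ t two_ne_zero] at this

lemma IsDoublingFor.measure_ball_two_pow_le (h : IsDoublingFor ρ μ D) (x : X) {t : ℝ}
    (ht : 0 < t) (n : ℕ) :
    μ {y | ρ x y < 2 ^ n * t} ≤ ENNReal.ofReal D ^ n * μ {y | ρ x y < t} := by
  induction n with
  | zero => simp
  | succ n ih =>
    calc μ {y | ρ x y < 2 ^ (n + 1) * t} = μ {y | ρ x y < 2 * (2 ^ n * t)} := by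
          rw [pow_succ', mul_assoc]
      _ ≤ ENNReal.ofReal D * μ {y | ρ x y < 2 ^ n * t} :=
          (h.doubling x (2 ^ n * t) (by positivity)).2.1
      _ ≤ ENNReal.ofReal D * (ENNReal.ofReal D ^ n * μ {y | ρ x y < t}) := by gcongr
      _ = _ := by rw [pow_succ', mul_assoc]

/-- Geometric doubling: the number of `t`-separated points in a ball of radius `R * t` is bounded
in terms of `κ`, `D` and `R` only. -/
lemma exists_card_separated_le (κ D R : ℝ) (hD : 0 ≤ D) (hR : 0 < R) :
    ∃ M : ℕ, ∀ (X : Type*) [MeasurableSpace X] (ρ : X → X → ℝ) (μ : Measure X),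
      IsQuasimetric ρ κ → IsDoublingFor ρ μ D → ∀ (t : ℝ), 0 < t → ∀ (x : X) (F : Finset X),
        (∀ z ∈ F, ρ x z < R * t) → (F : Set X).Pairwise (fun y z => t ≤ ρ y z) →
        F.card ≤ M := by
  obtain ⟨n, hn⟩ := pow_unbounded_of_one_lt (2 * κ * (κ * (R + κ * (R + 1 / (2 * κ)))))
    (one_lt_two : (1 : ℝ) < 2)
  refine ⟨⌊D ^ n⌋₊, fun X _ ρ μ h hμ t ht x F hFx hFsep => ?_⟩
  have hκ := h.pos
  set r := t / (2 * κ) with hr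
  have hr0 : 0 < r := by positivity
  set L := κ * (R * t + r) with hL
  have hL0 : 0 < L := by positivity
  have hdisj : (F : Set X).PairwiseDisjoint fun z => {y | ρ z y < r} := by
    intro z hz w hw hne
    refine Set.disjoint_left.2 fun y (hy : ρ z y < r) (hy' : ρ w y < r) => ?_
    have h1 := h.lt_of_lt_of_lt hy (h.comm w y ▸ hy')
    have h2 : t ≤ ρ z w := hFsep hz hw hne
    have h3 : κ * (r + r) = t := by rw [hr]; field_simp; ring
    linarith
  have hbig : ∀ z ∈ F, {y | ρ x y < L} ⊆ {y | ρ z y < 2 ^ n * r} := by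
    intro z hz y (hy : ρ x y < L)
    refine (h.lt_of_lt_of_lt (h.comm x z ▸ hFx z hz) hy).trans_le ?_
    have : κ * (R * t + L) = 2 * κ * (κ * (R + κ * (R + 1 / (2 * κ)))) * r := by
      rw [hL, hr]; field_simp
    rw [this]
    gcongr
  have hsub : (⋃ z ∈ F, {y | ρ z y < r}) ⊆ {y | ρ x y < L} :=
    iUnion₂_subset fun z hz y (hy : ρ z y < r) => h.lt_of_lt_of_lt (hFx z hz) hy
  have hmain : (F.card : ℝ≥0∞) * μ {y | ρ x y < L} ≤
      ENNReal.ofReal D ^ n * μ {y | ρ x y < L} := by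
    calc (F.card : ℝ≥0∞) * μ {y | ρ x y < L} = ∑ _z ∈ F, μ {y | ρ x y < L} := by
          rw [Finset.sum_const, nsmul_eq_mul]
      _ ≤ ∑ z ∈ F, ENNReal.ofReal D ^ n * μ {y | ρ z y < r} :=
          Finset.sum_le_sum fun z hz => (measure_mono (hbig z hz)).trans
            (hμ.measure_ball_two_pow_le z hr0 n)
      _ = ENNReal.ofReal D ^ n * μ (⋃ z ∈ F, {y | ρ z y < r}) := by
          rw [measure_biUnion_finset hdisj fun z _ => hμ.measurableSet_ball z r, Finset.mul_sum]
      _ ≤ _ := by gcongr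
  rw [ENNReal.mul_le_mul_iff_left (hμ.measure_ball_pos x hL0).ne' (hμ.doubling x L hL0).2.2.ne,
    ← ENNReal.ofReal_pow hD, ← ENNReal.ofReal_natCast,
    ENNReal.ofReal_le_ofReal_iff (by positivity)] at hmain
  exact Nat.le_floor hmain

lemma IsNetOf.finite_inter_ball (h : IsQuasimetric ρ κ) (hμ : IsDoublingFor ρ μ D) (hD : 0 ≤ D)
    {t : ℝ} (ht : 0 < t) {N : Set X} (hN : IsNetOf ρ t N) (x : X) (s : ℝ) :
    {z ∈ N | ρ x z < s}.Finite := by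
  rcases le_or_gt s 0 with hs | hs
  · convert Set.finite_empty (α := X)
    exact Set.eq_empty_of_forall_notMem fun z hz => (hz.2.trans_le hs).not_ge (h.nonneg x z)
  obtain ⟨M, hM⟩ := exists_card_separated_le κ D (s / t) hD (by positivity)
  by_contra hinf
  obtain ⟨F, hF, hcard⟩ := Set.Infinite.exists_subset_card_eq hinf (M + 1)
  have := hM X ρ μ h hμ t ht x F
    (fun z hz => by rw [div_mul_cancel₀ s ht.ne']; exact (hF hz).2)
    (hN.separated.mono fun z hz => (hF hz).1)
  omega

lemma IsNetOf.countable (h : IsQuasimetric ρ κ) (hμ : IsDoublingFor ρ μ D) (hD : 0 ≤ D)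
    {t : ℝ} (ht : 0 < t) {N : Set X} (hN : IsNetOf ρ t N) : N.Countable := by
  rcases isEmpty_or_nonempty X with hX | ⟨⟨x⟩⟩
  · exact N.to_countable
  refine (countable_iUnion fun n : ℕ => (hN.finite_inter_ball h hμ hD ht x n).countable).mono
    fun z hz => ?_
  obtain ⟨n, hn⟩ := exists_nat_gt (ρ x z)
  exact mem_iUnion.2 ⟨n, hz, hn⟩

end Doubling

/-- Measurable selection from countably many measurable sets covering the space. -/
lemma exists_measurable_selection {X Y : Type*} [MeasurableSpace X] {S : Set Y}
    (hS : S.Countable) {B : Y → Set X} (hB : ∀ z, MeasurableSet (B z))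
    (hcover : ∀ x, ∃ z ∈ S, x ∈ B z) :
    ∃ a : X → Y, (∀ x, x ∈ B (a x)) ∧ ∀ z, MeasurableSet {x | a x = z} := by
  classical
  rcases isEmpty_or_nonempty X with hX | ⟨⟨x₀⟩⟩
  · exact ⟨fun x => (hX.false x).elim, fun x => (hX.false x).elim,
      fun z => (Set.eq_empty_of_isEmpty {x : X | _ = z}) ▸ MeasurableSet.empty⟩
  obtain ⟨f, rfl⟩ := hS.exists_eq_range ((hcover x₀).imp fun _ h => h.1)
  have hex : ∀ x, ∃ n, x ∈ B (f n) := fun x => by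
    obtain ⟨_, ⟨n, rfl⟩, hn⟩ := hcover x
    exact ⟨n, hn⟩
  have hmeas : Measurable fun x => Nat.find (hex x) :=
    measurable_find hex fun n => hB (f n)
  exact ⟨fun x => f (Nat.find (hex x)), fun x => Nat.find_spec (hex x),
    fun z => hmeas (MeasurableSet.of_discrete (s := f ⁻¹' {z}))⟩

/-- A two-sided sequence built from an initial term by forward and backward steps. -/
lemma exists_int_chain {α : Type*} {P : ℤ → α → Prop} {r : ℤ → α → α → Prop}
    (h0 : ∃ a, P 0 a) (hsucc : ∀ k a, P k a → ∃ b, P (k + 1) b ∧ r k a b)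
    (hpred : ∀ k b, P (k + 1) b → ∃ a, P k a ∧ r k a b) :
    ∃ a : ℤ → α, (∀ k, P k (a k)) ∧ ∀ k, r k (a k) (a (k + 1)) := by
  obtain ⟨a₀, ha₀⟩ := h0
  choose! f hf hfr using hsucc
  choose! g hg hgr using hpred
  let u : ℕ → α := fun n => Nat.rec a₀ (fun m a => f m a) n
  let v : ℕ → α := fun n => Nat.rec a₀ (fun m a => g (Int.negSucc m) a) n
  have hu : ∀ n : ℕ, P n (u n) := fun n => by
    induction n with
    | zero => exact ha₀
    | succ n ih => exact_mod_cast hf n (u n) ih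
  have hcast : ∀ n : ℕ, Int.negSucc n + 1 = -(n : ℤ) := fun n => by omega
  have hv : ∀ n : ℕ, P (-(n : ℤ)) (v n) := fun n => by
    induction n with
    | zero => exact ha₀
    | succ n ih => exact hg (Int.negSucc n) (v n) (by rwa [hcast])
  let a : ℤ → α := fun k => if 0 ≤ k then u k.toNat else v (-k).toNat
  have ha : ∀ n : ℕ, a n = u n := fun n => by simp [a]
  have ha' : ∀ n : ℕ, a (-(n : ℤ)) = v n := fun n => by
    rcases n with _ | n
    · rfl
    · have : ¬ (0 : ℤ) ≤ -((n + 1 : ℕ) : ℤ) := by omega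
      simp only [a, if_neg this, neg_neg, Int.toNat_natCast]
  refine ⟨a, fun k => ?_, fun k => ?_⟩
  · rcases Int.eq_nat_or_neg k with ⟨n, rfl | rfl⟩
    · rw [ha]; exact hu n
    · rw [ha']; exact hv n
  · rcases k with n | n
    · have h1 := ha n
      have h2 := ha (n + 1)
      push_cast at h2
      simp only [Int.ofNat_eq_natCast]
      rw [h1, h2]
      exact hfr n (u n) (hu n)
    · have h1 := ha' (n + 1)
      rw [hcast, ha', show Int.negSucc n = -((n + 1 : ℕ) : ℤ) from rfl, h1]
      exact hgr (Int.negSucc n) (v n) (by rw [hcast]; exact hv n)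

section Cubes

variable {X : Type*} {ρ : X → X → ℝ} {κ : ℝ} {N : ℤ → Set X} {p : ℤ → X → X} {ℓ : ℤ → ℝ}

/-- The points within `ℓ (k + j)` of an element of `N (k + j)` whose `j`-fold parent under `p` is
the element `z` of `N k`. -/
def descendantBalls (ρ : X → X → ℝ) (N : ℤ → Set X) (p : ℤ → X → X) (ℓ : ℤ → ℝ) :
    ℕ → ℤ → X → Set X
  | 0, k, z => {x | z ∈ N k ∧ ρ z x < ℓ k}
  | j + 1, k, z => ⋃ w ∈ {w ∈ N (k + 1) | p k w = z}, descendantBalls ρ N p ℓ j (k + 1) w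

/-- The points lying in the `j`-th generation `descendantBalls` of `z` for infinitely many `j`. -/
def closedCube (ρ : X → X → ℝ) (N : ℤ → Set X) (p : ℤ → X → X) (ℓ : ℤ → ℝ) (k : ℤ) (z : X) :
    Set X :=
  {x | ∃ᶠ j in Filter.atTop, x ∈ descendantBalls ρ N p ℓ j k z}

lemma mem_descendantBalls_succ {j : ℕ} {k : ℤ} {x z : X} :
    x ∈ descendantBalls ρ N p ℓ (j + 1) k z ↔
      ∃ w ∈ N (k + 1), p k w = z ∧ x ∈ descendantBalls ρ N p ℓ j (k + 1) w := by
  simp [descendantBalls, and_assoc]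

lemma measurableSet_descendantBalls [MeasurableSpace X]
    (hball : ∀ (x : X) (t : ℝ), MeasurableSet {y | ρ x y < t}) (hN : ∀ k, (N k).Countable)
    (j : ℕ) (k : ℤ) (z : X) : MeasurableSet (descendantBalls ρ N p ℓ j k z) := by
  induction j generalizing k z with
  | zero => exact (MeasurableSet.const (z ∈ N k)).inter (hball z (ℓ k))
  | succ j ih =>
    exact MeasurableSet.biUnion ((hN (k + 1)).mono (sep_subset _ _)) fun w _ => ih (k + 1) w

lemma measurableSet_closedCube [MeasurableSpace X]
    (hball : ∀ (x : X) (t : ℝ), MeasurableSet {y | ρ x y < t}) (hN : ∀ k, (N k).Countable)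
    (k : ℤ) (z : X) : MeasurableSet (closedCube ρ N p ℓ k z) := by
  have : closedCube ρ N p ℓ k z = ⋂ n : ℕ, ⋃ j ≥ n, descendantBalls ρ N p ℓ j k z := by
    ext x
    simp [closedCube, Filter.frequently_atTop]
  rw [this]
  exact MeasurableSet.iInter fun n => MeasurableSet.iUnion fun j => MeasurableSet.iUnion fun _ =>
    measurableSet_descendantBalls hball hN j k z

lemma mem_and_lt_of_mem_descendantBalls (h : IsQuasimetric ρ κ)
    (hp : ∀ k w, p k w ∈ N k ∧ ρ w (p k w) < ℓ k) (hℓ : ∀ k, 2 * κ * ℓ (k + 1) ≤ ℓ k)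
    {j : ℕ} {k : ℤ} {x z : X} (hx : x ∈ descendantBalls ρ N p ℓ j k z) :
    z ∈ N k ∧ ρ z x < 2 * κ * ℓ k := by
  induction j generalizing k z with
  | zero =>
    have h1 := (h.nonneg z x).trans_lt hx.2
    exact ⟨hx.1, hx.2.trans_le (by nlinarith [h.one_le])⟩
  | succ j ih =>
    obtain ⟨w, -, rfl, hw⟩ := mem_descendantBalls_succ.1 hx
    refine ⟨(hp k w).1, (h.lt_of_lt_of_lt (h.comm w _ ▸ (hp k w).2) (ih hw).2).trans_le ?_⟩
    nlinarith [h.pos, hℓ k]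

lemma exists_mem_descendantBalls (h : IsQuasimetric ρ κ) (hN : ∀ k, IsNetOf ρ (ℓ k) (N k))
    (hp : ∀ k w, p k w ∈ N k ∧ ρ w (p k w) < ℓ k) (hℓ : ∀ k, 2 * κ * ℓ (k + 1) ≤ ℓ k)
    (j : ℕ) (k : ℤ) (x : X) : ∃ z, x ∈ descendantBalls ρ N p ℓ j k z := by
  induction j generalizing k with
  | zero =>
    obtain ⟨z, hz, hxz⟩ := (hN k).dense x
    exact ⟨z, hz, h.comm x z ▸ hxz⟩
  | succ j ih =>
    obtain ⟨w, hw⟩ := ih (k + 1)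
    exact ⟨p k w, mem_descendantBalls_succ.2
      ⟨w, (mem_and_lt_of_mem_descendantBalls h hp hℓ hw).1, rfl, hw⟩⟩

lemma mem_and_lt_of_mem_closedCube (h : IsQuasimetric ρ κ)
    (hp : ∀ k w, p k w ∈ N k ∧ ρ w (p k w) < ℓ k) (hℓ : ∀ k, 2 * κ * ℓ (k + 1) ≤ ℓ k)
    {k : ℤ} {x z : X} (hx : x ∈ closedCube ρ N p ℓ k z) : z ∈ N k ∧ ρ z x < 2 * κ * ℓ k := by
  obtain ⟨j, hj⟩ := Filter.Frequently.exists hx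
  exact mem_and_lt_of_mem_descendantBalls h hp hℓ hj

lemma mem_closedCube_iff_frequently_succ {k : ℤ} {x z : X} :
    x ∈ closedCube ρ N p ℓ k z ↔
      ∃ᶠ j in Filter.atTop, x ∈ descendantBalls ρ N p ℓ (j + 1) k z := by
  change (∃ᶠ j in Filter.atTop, _) ↔ _
  conv_lhs => rw [← Filter.map_add_atTop_eq_nat 1, Filter.frequently_map]

lemma closedCube_subset_parent {k : ℤ} {w : X} (hw : w ∈ N (k + 1)) :
    closedCube ρ N p ℓ (k + 1) w ⊆ closedCube ρ N p ℓ k (p k w) := fun _ hx =>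
  mem_closedCube_iff_frequently_succ.2 <| Filter.Frequently.mono hx fun _ hj =>
    mem_descendantBalls_succ.2 ⟨w, hw, rfl, hj⟩

lemma frequently_exists_of_finite {α β : Type*} {f : Filter α} {F : Set β} (hF : F.Finite)
    {P : α → β → Prop} (h : ∃ᶠ j in f, ∃ z ∈ F, P j z) : ∃ z ∈ F, ∃ᶠ j in f, P j z := by
  contrapose! h
  exact (Filter.eventually_all_finite hF).2 h

lemma exists_mem_closedCube (h : IsQuasimetric ρ κ) (hN : ∀ k, IsNetOf ρ (ℓ k) (N k))
    (hp : ∀ k w, p k w ∈ N k ∧ ρ w (p k w) < ℓ k) (hℓ : ∀ k, 2 * κ * ℓ (k + 1) ≤ ℓ k)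
    (hfin : ∀ k x s, {z ∈ N k | ρ x z < s}.Finite) (k : ℤ) (x : X) :
    ∃ z, x ∈ closedCube ρ N p ℓ k z := by
  obtain ⟨z, -, hz⟩ := frequently_exists_of_finite (f := Filter.atTop)
    (P := fun j z => x ∈ descendantBalls ρ N p ℓ j k z) (hfin k x (2 * κ * ℓ k))
    (Filter.Frequently.of_forall fun j => by
      obtain ⟨z, hz⟩ := exists_mem_descendantBalls h hN hp hℓ j k x
      obtain ⟨h1, h2⟩ := mem_and_lt_of_mem_descendantBalls h hp hℓ hz
      exact ⟨z, ⟨h1, h.comm x z ▸ h2⟩, hz⟩)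
  exact ⟨z, hz⟩

lemma exists_child_of_mem_closedCube (h : IsQuasimetric ρ κ)
    (hp : ∀ k w, p k w ∈ N k ∧ ρ w (p k w) < ℓ k) (hℓ : ∀ k, 2 * κ * ℓ (k + 1) ≤ ℓ k)
    (hfin : ∀ k x s, {z ∈ N k | ρ x z < s}.Finite) {k : ℤ} {x z : X}
    (hx : x ∈ closedCube ρ N p ℓ k z) :
    ∃ w, p k w = z ∧ x ∈ closedCube ρ N p ℓ (k + 1) w := by
  obtain ⟨w, -, hw⟩ := frequently_exists_of_finite
    (P := fun j w => p k w = z ∧ x ∈ descendantBalls ρ N p ℓ j (k + 1) w)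
    (hfin (k + 1) x (2 * κ * ℓ (k + 1)))
    ((mem_closedCube_iff_frequently_succ.1 hx).mono fun j hj => by
      obtain ⟨w, -, hwz, hw⟩ := mem_descendantBalls_succ.1 hj
      obtain ⟨h1, h2⟩ := mem_and_lt_of_mem_descendantBalls h hp hℓ hw
      exact ⟨w, ⟨h1, h.comm x w ▸ h2⟩, hwz, hw⟩)
  obtain ⟨-, hwz, -⟩ := hw.exists
  exact ⟨w, hwz, hw.mono fun _ hj => hj.2⟩

/-- Measurable half-open cubes: `a k x` is the centre of the `k`-th generation cube of `x`. -/
lemma exists_cube_assignment [MeasurableSpace X] (h : IsQuasimetric ρ κ)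
    (hball : ∀ (x : X) (t : ℝ), MeasurableSet {y | ρ x y < t}) (hN : ∀ k, IsNetOf ρ (ℓ k) (N k))
    (hcount : ∀ k, (N k).Countable)
    (hp : ∀ k w, p k w ∈ N k ∧ ρ w (p k w) < ℓ k) (hℓ : ∀ k, 2 * κ * ℓ (k + 1) ≤ ℓ k)
    (hfin : ∀ k x s, {z ∈ N k | ρ x z < s}.Finite) :
    ∃ a : ℤ → X → X, (∀ k x, x ∈ closedCube ρ N p ℓ k (a k x)) ∧
      (∀ k z, MeasurableSet {x | a k x = z}) ∧ ∀ k x, p k (a (k + 1) x) = a k x := by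
  have hmem : ∀ {k x z}, x ∈ closedCube ρ N p ℓ k z → z ∈ N k := fun hx =>
    (mem_and_lt_of_mem_closedCube h hp hℓ hx).1
  obtain ⟨a, ha, hpa⟩ := exists_int_chain
    (P := fun k (a : X → X) => (∀ x, x ∈ closedCube ρ N p ℓ k (a x)) ∧
      ∀ z, MeasurableSet {x | a x = z})
    (r := fun k a b => ∀ x, p k (b x) = a x)
    (exists_measurable_selection (hcount 0) (measurableSet_closedCube hball hcount 0) fun x =>
      (exists_mem_closedCube h hN hp hℓ hfin 0 x).imp fun z hz => ⟨hmem hz, hz⟩)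
    (fun k a ⟨hak, ham⟩ => by
      obtain ⟨b, hb, hbm⟩ := exists_measurable_selection (hcount (k + 1))
        (B := fun w => closedCube ρ N p ℓ (k + 1) w ∩ {x | a x = p k w})
        (fun w => (measurableSet_closedCube hball hcount (k + 1) w).inter (ham (p k w)))
        (fun x => by
          obtain ⟨w, hwx, hw⟩ := exists_child_of_mem_closedCube h hp hℓ hfin (hak x)
          exact ⟨w, hmem hw, hw, hwx.symm⟩)
      exact ⟨b, ⟨fun x => (hb x).1, hbm⟩, fun x => (hb x).2.symm⟩)
    (fun k b ⟨hbk, hbm⟩ => by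
      refine ⟨fun x => p k (b x), ⟨fun x => closedCube_subset_parent (hmem (hbk x)) (hbk x),
        fun z => ?_⟩, fun x => rfl⟩
      have : {x | p k (b x) = z} = ⋃ w ∈ {w ∈ N (k + 1) | p k w = z}, {x | b x = w} := by
        ext x
        simp [hmem (hbk x)]
      rw [this]
      exact MeasurableSet.biUnion ((hcount (k + 1)).mono (sep_subset _ _)) fun w _ => hbm w)
  exact ⟨a, fun k => (ha k).1, fun k => (ha k).2, hpa⟩

lemma eq_of_mem_closedCube_of_lt (h : IsQuasimetric ρ κ)
    (hp : ∀ k w, p k w ∈ N k ∧ ρ w (p k w) < ℓ k) (hℓ : ∀ k, 2 * κ * ℓ (k + 1) ≤ ℓ k)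
    {k : ℤ} (hpk : ∀ w, ∀ z ∈ N k, ρ w z < ℓ k / (2 * κ) → p k w = z) {s : ℝ}
    (hs : κ * (2 * κ * ℓ (k + 1) + s) ≤ ℓ k / (2 * κ)) {x z z' : X} (hz : z ∈ N k)
    (hzx : ρ z x < s) (hx : x ∈ closedCube ρ N p ℓ k z') : z' = z := by
  obtain ⟨j, hj⟩ := (mem_closedCube_iff_frequently_succ.1 hx).exists
  obtain ⟨w, -, rfl, hw⟩ := mem_descendantBalls_succ.1 hj
  exact hpk w z hz ((h.lt_of_lt_of_lt (mem_and_lt_of_mem_descendantBalls h hp hℓ hw).2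
    (h.comm z x ▸ hzx)).trans_le hs)

end Cubes

/-- A single system: for nets of mesh `8 * κ ^ 3 * δ ^ k`, a measurable consistent choice `a k x`
of the centre of the `k`-th generation cube of `x`. -/
lemma exists_dyadic_assignment {X : Type*} [MeasurableSpace X] {ρ : X → X → ℝ} {μ : Measure X}
    {κ D δ : ℝ} (h : IsQuasimetric ρ κ) (hμ : IsDoublingFor ρ μ D) (hD : 0 ≤ D)
    (hδ : 8 * κ ^ 3 * δ = 1) {N : ℤ → Set X}
    (hN : ∀ k, IsNetOf ρ (8 * κ ^ 3 * δ ^ k) (N k)) :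
    ∃ a : ℤ → X → X, (∀ k z, MeasurableSet {x | a k x = z}) ∧
      (∀ k l, l ≤ k → ∀ x y, a k x = a k y → a l x = a l y) ∧
      (∀ k x, a k x ∈ N k ∧ ρ (a k x) x < 16 * κ ^ 4 * δ ^ k) ∧
      ∀ k, ∀ z ∈ N k, ∀ x, ρ z x < 2 * κ * δ ^ k → a k x = z := by
  have hκ := h.pos
  have hδ0 : 0 < δ := by
    by_contra! hle
    have : 8 * κ ^ 3 * δ ≤ 0 := mul_nonpos_of_nonneg_of_nonpos (by positivity) hle
    linarith
  have hpos : ∀ k : ℤ, 0 < δ ^ k := fun k => zpow_pos hδ0 k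
  have hmesh : ∀ k : ℤ, 0 < 8 * κ ^ 3 * δ ^ k := fun k => by have := hpos k; positivity
  have hnext : ∀ k : ℤ, 8 * κ ^ 3 * δ ^ (k + 1) = δ ^ k := fun k => by
    rw [zpow_add_one₀ hδ0.ne', mul_comm (δ ^ k) δ, ← mul_assoc, hδ, one_mul]
  choose p hp hpk using fun k => h.exists_projection (hN k)
  have hℓ : ∀ k : ℤ, 2 * κ * (8 * κ ^ 3 * δ ^ (k + 1)) ≤ 8 * κ ^ 3 * δ ^ k := fun k => by
    rw [hnext]
    have : κ ≤ κ ^ 3 := le_self_pow₀ h.one_le three_ne_zero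
    exact mul_le_mul_of_nonneg_right (by linarith [hκ]) (hpos k).le
  obtain ⟨a, ha, ham, hpa⟩ := exists_cube_assignment h hμ.measurableSet_ball hN
    (fun k => (hN k).countable h hμ hD (hmesh k)) hp hℓ
    (fun k x s => (hN k).finite_inter_ball h hμ hD (hmesh k) x s)
  refine ⟨a, ham, fun k l hlk x y hxy => ?_, fun k x => ?_, fun k z hz x hzx => ?_⟩
  · induction l, hlk using Int.leInductionDown with
    | base => exact hxy
    | pred l _ ih => rw [← hpa (l - 1), ← hpa (l - 1), sub_add_cancel, ih]
  · obtain ⟨h1, h2⟩ := mem_and_lt_of_mem_closedCube h hp hℓ (ha k x)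
    exact ⟨h1, h2.trans_eq (by ring)⟩
  · refine eq_of_mem_closedCube_of_lt h hp hℓ (hpk k) (le_of_eq ?_) hz hzx (ha k x)
    rw [hnext]
    field_simp
    ring

lemma exists_zpow_mem_Icc {δ s : ℝ} (hδ : 0 < δ) (hδ1 : δ < 1) (hs : 0 < s) :
    ∃ k : ℤ, s ≤ δ ^ k ∧ δ ^ k ≤ δ⁻¹ * s := by
  obtain ⟨n, h1, h2⟩ := exists_mem_Ioc_zpow hs ((one_lt_inv₀ hδ).2 hδ1)
  refine ⟨-(n + 1), by rwa [inv_zpow'] at h2, ?_⟩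
  rw [inv_zpow'] at h1
  rw [neg_add, ← sub_eq_add_neg, zpow_sub_one₀ hδ.ne', mul_comm]
  gcongr

lemma IsDoublingFor.measure_le_of_subset_ball {X : Type*} [MeasurableSpace X] {ρ : X → X → ℝ}
    {μ : Measure X} {κ D : ℝ} (hμ : IsDoublingFor ρ μ D) (h : IsQuasimetric ρ κ) (hD : 0 < D)
    {r s : ℝ} (hr : 0 < r) {n : ℕ} (hn : κ * (s + s) ≤ 2 ^ n * r) {x z : X} (hxz : ρ x z < s)
    {A B : Set X} (hA : A ⊆ {y | ρ x y < s}) (hB : {y | ρ z y < r} ⊆ B) :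
    ENNReal.ofReal (1 / (D ^ n + 1)) * μ A ≤ μ B := by
  have hAz : A ⊆ {y | ρ z y < 2 ^ n * r} := fun y hy =>
    (h.lt_of_lt_of_lt (h.comm x z ▸ hxz) (hA hy)).trans_le hn
  have hconst : ENNReal.ofReal (1 / (D ^ n + 1)) * ENNReal.ofReal D ^ n ≤ 1 := by
    rw [← ENNReal.ofReal_pow hD.le, ← ENNReal.ofReal_mul (by positivity), ENNReal.ofReal_le_one,
      one_div_mul_eq_div, div_le_one (by positivity)]
    linarith
  calc ENNReal.ofReal (1 / (D ^ n + 1)) * μ A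
      ≤ ENNReal.ofReal (1 / (D ^ n + 1)) * (ENNReal.ofReal D ^ n * μ {y | ρ z y < r}) := by
        gcongr
        exact (measure_mono hAz).trans (hμ.measure_ball_two_pow_le z hr n)
    _ ≤ 1 * μ {y | ρ z y < r} := by
        rw [← mul_assoc]
        gcongr
    _ ≤ μ B := by
        rw [one_mul]
        exact measure_mono hB

/-- Adjacent (three-lattice) dyadic systems theorem for a space of
homogeneous type: there are finitely many dyadic systems, with common constants depending
only on `κ` and `D`, such that every ball is contained in a cube of comparable size belonging
to one of the systems. -/
theorem adjacent_dyadic_systems (κ D : ℝ) (hκ : 1 ≤ κ) (hD : 0 < D) :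
    ∃ (K₀ : ℕ) (c𝔠 δ ε₀ ctil : ℝ), 1 ≤ K₀ ∧ 0 < c𝔠 ∧ 0 < δ ∧ δ < 1 ∧ 0 < ε₀ ∧ ε₀ < 1 ∧
      0 < ctil ∧
      ∀ (X : Type) (_ : MeasurableSpace X) (_ : Nonempty X) (ρ : X → X → ℝ)
        (μ : Measure X),
        (∀ x y : X, 0 ≤ ρ x y) →
        (∀ x y : X, ρ x y = 0 ↔ x = y) →
        (∀ x y : X, ρ x y = ρ y x) →
        (∀ x y z : X, ρ x y ≤ κ * (ρ x z + ρ z y)) →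
        (∀ (x : X) (t : ℝ), MeasurableSet {y : X | ρ x y < t}) →
        (∀ (x : X) (t : ℝ), 0 < t →
          0 < μ {y : X | ρ x y < 2 * t} ∧
          μ {y : X | ρ x y < 2 * t} ≤ ENNReal.ofReal D * μ {y : X | ρ x y < t} ∧
          μ {y : X | ρ x y < t} < ⊤) →
        ∃ (𝒟 : Fin K₀ → ℤ → Set (Set X)) (c : Fin K₀ → ℤ → Set X → X),
          (∀ i : Fin K₀,
            (∀ k : ℤ, ∀ Q ∈ 𝒟 i k, MeasurableSet Q) ∧
            -- (1) each generation covers X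
            (∀ (k : ℤ) (x : X), ∃ Q ∈ 𝒟 i k, x ∈ Q) ∧
            -- (2) any two cubes of the same system are nested or disjoint
            (∀ (k l : ℤ), ∀ Q₁ ∈ 𝒟 i k, ∀ Q₂ ∈ 𝒟 i l, (Q₁ ∩ Q₂).Nonempty →
              Q₁ ⊆ Q₂ ∨ Q₂ ⊆ Q₁) ∧
            -- (3) every cube has at least one child
            (∀ (k : ℤ), ∀ Q ∈ 𝒟 i k, ∃ Q' ∈ 𝒟 i (k + 1), Q' ⊆ Q) ∧
            -- (4) every cube has exactly one parent
            (∀ (k : ℤ), ∀ Q ∈ 𝒟 i k, ∃! Q' : Set X, Q' ∈ 𝒟 i (k - 1) ∧ Q ⊆ Q') ∧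
            -- (5) children have comparable measure
            (∀ (k : ℤ), ∀ Q ∈ 𝒟 i k, ∀ Q' ∈ 𝒟 i (k + 1), Q' ⊆ Q →
              ENNReal.ofReal ε₀ * μ Q ≤ μ Q') ∧
            -- (6) sandwich property
            (∀ (k : ℤ), ∀ Q ∈ 𝒟 i k,
              {y : X | ρ (c i k Q) y < δ ^ k} ⊆ Q ∧
              Q ⊆ {y : X | ρ (c i k Q) y < c𝔠 * δ ^ k})) ∧
          -- every ball is contained in a cube of comparable size from one of the systems
          (∀ (x : X) (s : ℝ), 0 < s →
            ∃ (i : Fin K₀) (k : ℤ), ∃ Q ∈ 𝒟 i k,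
              {y : X | ρ x y < s} ⊆ Q ∧ δ ^ k ≤ ctil * s) := by
  have hκ0 : 0 < κ := by linarith
  have h8 : 8 ≤ 8 * κ ^ 3 := by linarith [one_le_pow₀ hκ (n := 3)]
  obtain ⟨δ, hδ⟩ : ∃ δ : ℝ, 8 * κ ^ 3 * δ = 1 := ⟨(8 * κ ^ 3)⁻¹, mul_inv_cancel₀ (by positivity)⟩
  have hδ0 : 0 < δ := pos_of_mul_pos_right (hδ.symm ▸ one_pos) (by positivity)
  have hδ1 : δ < 1 := by nlinarith
  obtain ⟨M, hM⟩ := exists_card_separated_le κ D (8 * κ ^ 3) hD.le (by positivity)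
  obtain ⟨n, hn⟩ := pow_unbounded_of_one_lt (κ * (16 * κ ^ 4 + 16 * κ ^ 4) / δ)
    (one_lt_two : (1 : ℝ) < 2)
  rw [div_lt_iff₀ hδ0] at hn
  refine ⟨M + 1, 16 * κ ^ 4, δ, 1 / (D ^ n + 1), δ⁻¹, by omega, by positivity, hδ0, hδ1,
    by positivity, by rw [div_lt_one (by positivity)]; linarith [pow_pos hD n], by positivity, ?_⟩
  intro X _ _ ρ μ hnonneg hzero hcomm htri hmeas hdoub
  have h : IsQuasimetric ρ κ := ⟨hκ, hnonneg, hzero, hcomm, htri⟩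
  have hμ : IsDoublingFor ρ μ D := ⟨hmeas, hdoub⟩
  have hpos : ∀ k : ℤ, 0 < δ ^ k := fun k => zpow_pos hδ0 k
  have hmesh : ∀ k : ℤ, 0 < 8 * κ ^ 3 * δ ^ k := fun k => by have := hpos k; positivity
  choose N hN hNdense using fun k : ℤ => h.exists_nets (hmesh k) (hpos k) (M + 1)
  have hNcover : ∀ (k : ℤ) (x : X), ∃ i < M + 1, ∃ z ∈ N k i, ρ x z < δ ^ k := fun k x => by
    refine (hNdense k x).resolve_right ?_
    rintro ⟨F, hcard, hFx, hFsep⟩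
    have := hM X ρ μ h hμ (δ ^ k) (hpos k) x F (fun z hz => (hFx z hz).1) hFsep
    omega
  choose a ham hanest hadist hainner using fun i : ℕ =>
    exists_dyadic_assignment h hμ hD.le hδ (N := fun k => N k i) fun k => hN k i
  have hcenter : ∀ i k x, a i k (Classical.epsilon (· ∈ {y | a i k y = a i k x})) = a i k x :=
    fun i k x => Classical.epsilon_spec (p := (· ∈ {y | a i k y = a i k x})) ⟨x, rfl⟩
  have hin : ∀ i k x, {y | ρ (a i k x) y < δ ^ k} ⊆ {y | a i k y = a i k x} :=
    fun i k x y (hy : ρ (a i k x) y < δ ^ k) =>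
      hainner i k _ (hadist i k x).1 y (hy.trans_le (by nlinarith [hpos k]))
  have hout : ∀ i k x, {y | a i k y = a i k x} ⊆ {y | ρ (a i k x) y < 16 * κ ^ 4 * δ ^ k} :=
    fun i k x y (hy : a i k y = a i k x) => hy ▸ (hadist i k y).2
  refine ⟨fun i k => range fun x => {y | a i k y = a i k x},
    fun i k Q => a i k (Classical.epsilon (· ∈ Q)), fun i => ⟨?_, ?_, ?_, ?_, ?_, ?_, ?_⟩, ?_⟩
  · rintro k _ ⟨x, rfl⟩
    exact ham i k _
  · exact fun k x => ⟨_, ⟨x, rfl⟩, rfl⟩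
  · rintro k l _ ⟨x, rfl⟩ _ ⟨y, rfl⟩ ⟨z, hzx : a i k z = a i k x, hzy : a i l z = a i l y⟩
    rcases le_total l k with hlk | hkl
    · exact Or.inl fun w hw => (hanest i k l hlk w z (hw.trans hzx.symm)).trans hzy
    · exact Or.inr fun w hw => (hanest i l k hkl w z (hw.trans hzy.symm)).trans hzx
  · rintro k _ ⟨x, rfl⟩
    exact ⟨_, ⟨x, rfl⟩, fun y hy => hanest i (k + 1) k (by omega) y x hy⟩
  · rintro k _ ⟨x, rfl⟩
    refine ⟨{y | a i (k - 1) y = a i (k - 1) x},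
      ⟨⟨x, rfl⟩, fun y hy => hanest i k (k - 1) (by omega) y x hy⟩, ?_⟩
    rintro _ ⟨⟨z, rfl⟩, hsub⟩
    have hxz : a i (k - 1) x = a i (k - 1) z := hsub (show x ∈ {y | a i k y = a i k x} from rfl)
    simp only [hxz]
  · rintro k _ ⟨x, rfl⟩ _ ⟨y, rfl⟩ hsub
    refine hμ.measure_le_of_subset_ball h hD (hpos (k + 1)) (s := 16 * κ ^ 4 * δ ^ k) ?_
      (hout i k x (hsub (hin i (k + 1) y ?_))) (hout i k x) (hin i (k + 1) y)
    · rw [zpow_add_one₀ hδ0.ne']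
      nlinarith [hpos k]
    · exact (h.self _).trans_lt (hpos (k + 1))
  · rintro k _ ⟨x, rfl⟩
    simp only [hcenter]
    exact ⟨hin i k x, hout i k x⟩
  · intro x s hs
    obtain ⟨k, hsk, hks⟩ := exists_zpow_mem_Icc hδ0 hδ1 hs
    obtain ⟨i, hi, z, hz, hxz⟩ := hNcover k x
    have hball : ∀ y, ρ x y < s → a i k y = z := fun y hy => hainner i k z hz y <|
      (h.lt_of_lt_of_lt (h.comm x z ▸ hxz) (hy.trans_le hsk)).trans_eq (by ring)
    refine ⟨⟨i, hi⟩, k, _, ⟨x, rfl⟩, fun y hy => ?_, hks⟩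
    exact (hball y hy).trans (hball x ((h.self x).trans_lt hs)).symm
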